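/- In a finite deterministic episodic MDP with behavior policy β, the (H−1)-step reinforced RCSL policy satisfies J(π̃^{H−1,⋆}_β) = E_{s∼ρ}[V_1^{⋆,β}(s)], i.e., multi-step return relabeling with H−1 passes recovers the optimal value achievable by any policy whose action supports are contained in those of β. -/

import Mathlib

open Finset

namespace RCSL

noncomputable section

/-- Real-valued indicator of a proposition. -/
def ind (P : Prop) : ℝ :=
  haveI := Classical.propDecidable P
  if P then 1 else 0

/-- A finite deterministic episodic MDP with horizon `H`.  Stages are 0-indexed
(`0, …, H-1` here corresponds to the paper's stages `1, …, H`). -/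
structure DetMDP (S A : Type) [Fintype S] [Fintype A] (H : ℕ) where
  /-- deterministic transition function -/
  step : ℕ → S → A → S
  /-- deterministic reward function -/
  r : ℕ → S → A → ℝ
  r_nonneg : ∀ h s a, 0 ≤ r h s a
  r_le_one : ∀ h s a, r h s a ≤ 1
  /-- initial state distribution -/
  ρ : S → ℝ
  ρ_nonneg : ∀ s, 0 ≤ ρ s
  ρ_sum_one : ∑ s, ρ s = 1

/-- Stagewise weight functions on actions; genuine policies are those satisfying `IsPolicy`. -/
abbrev Pol (S A : Type) := ℕ → S → A → ℝ

variable {S A : Type} [Fintype S] [Fintype A] [Nonempty S] [Nonempty A] {H : ℕ}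

/-- `π` is a genuine stagewise policy: at every stage and state it is a
probability distribution on actions. -/
def IsPolicy (π : Pol S A) : Prop :=
  (∀ h s a, 0 ≤ π h s a) ∧ ∀ h s, ∑ a, π h s a = 1

/-- Length-`H` trajectories: a state–action pair at every stage. -/
abbrev Traj (S A : Type) (H : ℕ) := Fin H → S × A

/-- The state of trajectory `τ` at (0-indexed) stage `h`. -/
def stAt (τ : Traj S A H) (h : ℕ) : S :=
  if hh : h < H then (τ ⟨h, hh⟩).1 else Classical.arbitrary S

/-- The action of trajectory `τ` at (0-indexed) stage `h`. -/
def actAt (τ : Traj S A H) (h : ℕ) : A :=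
  if hh : h < H then (τ ⟨h, hh⟩).2 else Classical.arbitrary A

/-- The probability `P_β(τ)` of trajectory `τ` when the initial state is drawn from `ρ`,
actions are drawn from the policy `β`, and states follow the deterministic dynamics. -/
def trajProb (M : DetMDP S A H) (β : Pol S A) (τ : Traj S A H) : ℝ :=
  (if 0 < H then M.ρ (stAt τ 0) else 1) *
    (∏ h : Fin H, β h (stAt τ h) (actAt τ h)) *
    ∏ h : Fin H, (if (h : ℕ) + 1 < H then
      ind (stAt τ ((h : ℕ) + 1) = M.step h (stAt τ h) (actAt τ h)) else 1)

/-- The return-to-go `g_h(τ) = Σ_{t ≥ h} r_t(s_t, a_t)` of trajectory `τ` from stage `h`. -/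
def rtg (M : DetMDP S A H) (h : ℕ) (τ : Traj S A H) : ℝ :=
  ∑ t : Fin H, if h ≤ (t : ℕ) then M.r t (stAt τ t) (actAt τ t) else 0

/-- The stage-`h` state occupancy measure `d_h^π` of policy `π`. -/
def occ (M : DetMDP S A H) (π : Pol S A) : ℕ → S → ℝ
  | 0 => M.ρ
  | n + 1 => fun s' => ∑ s, ∑ a, occ M π n s * π n s a * ind (M.step n s a = s')

/-- The expected total reward `J(π)` of policy `π`. -/
def J (M : DetMDP S A H) (π : Pol S A) : ℝ :=
  ∑ h ∈ Finset.range H, ∑ s, ∑ a, occ M π h s * π h s a * M.r h s a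

/-- The conditional action probability `P_β(a_h = a ∣ s_h = s, g_h = g)`. -/
def condA (M : DetMDP S A H) (β : Pol S A) (h : ℕ) (s : S) (g : ℝ) (a : A) : ℝ :=
  (∑ τ : Traj S A H, trajProb M β τ * ind (stAt τ h = s ∧ actAt τ h = a ∧ rtg M h τ = g)) /
    ∑ τ : Traj S A H, trajProb M β τ * ind (stAt τ h = s ∧ rtg M h τ = g)

/-- The in-distribution optimal return-to-go `f⋆(s, h)`: the largest return-to-go at `(s, h)`
along trajectories that are feasible under the behavior policy `β`. -/
def fstar (M : DetMDP S A H) (β : Pol S A) (s : S) (h : ℕ) : ℝ :=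
  sSup {g : ℝ | ∃ τ : Traj S A H, 0 < trajProb M β τ ∧ stAt τ h = s ∧ rtg M h τ = g}

/-- The return-conditioned policy `π_f(a ∣ s, h) = P_β(a_h = a ∣ s_h = s, g_h = f(s, h))`. -/
def rcPolicy (M : DetMDP S A H) (β : Pol S A) (f : S → ℕ → ℝ) : Pol S A :=
  fun h s a => condA M β h s (f s h) a

/-- The in-distribution optimal stitched policy `π⋆_β = π_{f⋆}`. -/
def piStar (M : DetMDP S A H) (β : Pol S A) : Pol S A :=
  rcPolicy M β fun s h => fstar M β s h

/-- Probability that an i.i.d. dataset of `N` trajectories drawn from `P_β` satisfies `E`. -/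
def datasetProb (M : DetMDP S A H) (β : Pol S A) (N : ℕ)
    (E : (Fin N → Traj S A H) → Prop) : ℝ :=
  ∑ D : Fin N → Traj S A H, (∏ k, trajProb M β (D k)) * ind (E D)

/-- `f` (with domain `dom ⊆ S × {0, …, H-1}`) is a feasible conditioning function
(`f ∈ F_β`). -/
def IsFeasibleCond (M : DetMDP S A H) (β : Pol S A) (f : S → ℕ → ℝ)
    (dom : Set (S × ℕ)) : Prop :=
  ∀ p ∈ dom, p.2 < H ∧
    ∃ τ : Traj S A H, 0 < trajProb M β τ ∧ stAt τ p.2 = p.1 ∧ rtg M p.2 τ = f p.1 p.2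

/-- `f` is a consistent feasible conditioning function (`f ∈ F^Cst_β`): its domain contains
`(s, 0)` for every initial state `s` in the support of `ρ`, the conditioned initial return
occurs with positive probability under `β` from `s`, and along every trajectory generated by
`π_f` one has `f(s_h, h) = r_h(s_h, a_h) + f(s_{h+1}, h+1)` (with the convention that the
term `f(s_{H+1}, H+1)` beyond the horizon is `0`). -/
def IsConsistentCond (M : DetMDP S A H) (β : Pol S A) (f : S → ℕ → ℝ)
    (dom : Set (S × ℕ)) : Prop :=
  IsFeasibleCond M β f dom ∧
    (∀ s, 0 < M.ρ s → (s, 0) ∈ dom) ∧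
    (∀ s, 0 < M.ρ s →
      ∃ τ : Traj S A H, 0 < trajProb M β τ ∧ stAt τ 0 = s ∧ rtg M 0 τ = f s 0) ∧
    ∀ τ : Traj S A H, 0 < trajProb M (rcPolicy M β f) τ → ∀ h, h < H →
      (stAt τ h, h) ∈ dom ∧
        f (stAt τ h) h = M.r h (stAt τ h) (actAt τ h) +
          (if h + 1 < H then f (stAt τ (h + 1)) (h + 1) else 0)

end

end RCSL

namespace RCSL

noncomputable section

variable {S A : Type} [Fintype S] [Fintype A] [Nonempty S] [Nonempty A] {H : ℕ}

/-- Value of policy `π` at stage `h` and state `s` when `n` steps remain. -/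
def Vaux (M : DetMDP S A H) (π : Pol S A) : ℕ → ℕ → S → ℝ
  | 0, _, _ => 0
  | n + 1, h, s => ∑ a, π h s a * (M.r h s a + Vaux M π n (h + 1) (M.step h s a))

/-- The value function `V_h^π(s)`: expected total reward from stage `h` starting at `s`
under `π` (it vanishes for `h ≥ H`). -/
def V (M : DetMDP S A H) (π : Pol S A) (h : ℕ) (s : S) : ℝ :=
  Vaux M π (H - h) h s

/-- The class `Π_β`: genuine policies whose action distributions are absolutely continuous
with respect to those of `β` at every state and stage. -/
def PolCovered (β π : Pol S A) : Prop :=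
  IsPolicy π ∧ ∀ h s a, 0 < π h s a → 0 < β h s a

/-- The `β`-covered optimal value function `V_h^{⋆,β}(s) = max_{π ∈ Π_β} V_h^π(s)`. -/
def Vstar (M : DetMDP S A H) (β : Pol S A) (h : ℕ) (s : S) : ℝ :=
  sSup {v : ℝ | ∃ π : Pol S A, PolCovered β π ∧ V M π h s = v}

/-- The `β`-covered optimal Q-function
`Q_h^{⋆,β}(s, a) = r_h(s, a) + V_{h+1}^{⋆,β}(P_h(s, a))`. -/
def Qstar (M : DetMDP S A H) (β : Pol S A) (h : ℕ) (s : S) (a : A) : ℝ :=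
  M.r h s a + Vstar M β (h + 1) (M.step h s a)

/-- The multi-step relabeled return-to-go `g̃^k_h(τ)`: `g̃^0_h = g_h`, the label at the last
stage is carried over from the previous pass, and for `h + 1 < H` (1-indexed `h ≤ H - 1`),
`g̃^k_h(τ) = max{r_h + f⋆_{k-1}(s_{h+1}(τ), h+1), r_h + g̃^k_{h+1}(τ)}`, where
`f⋆_{k-1}(s, h) = max{g̃^{k-1}_h(τ') : τ' ∈ T_β, s_h(τ') = s}`. -/
def gtilde (M : DetMDP S A H) (β : Pol S A) : ℕ → ℕ → Traj S A H → ℝ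
  | 0, h, τ => rtg M h τ
  | k + 1, h, τ =>
    if h + 1 < H then
      max
        (M.r h (stAt τ h) (actAt τ h) +
          sSup {g : ℝ | ∃ τ' : Traj S A H, 0 < trajProb M β τ' ∧
            stAt τ' (h + 1) = stAt τ (h + 1) ∧ gtilde M β k (h + 1) τ' = g})
        (M.r h (stAt τ h) (actAt τ h) + gtilde M β (k + 1) (h + 1) τ)
    else gtilde M β k h τ
  termination_by k h _ => (k, H - h)
  decreasing_by
  · exact Prod.Lex.left _ _ (Nat.lt_succ_self k)
  · exact Prod.Lex.right _ (by omega)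
  · exact Prod.Lex.left _ _ (Nat.lt_succ_self k)

/-- The optimal `k`-pass-relabeled return-to-go `f⋆_k(s, h)`. -/
def fstark (M : DetMDP S A H) (β : Pol S A) (k : ℕ) (s : S) (h : ℕ) : ℝ :=
  sSup {g : ℝ | ∃ τ : Traj S A H, 0 < trajProb M β τ ∧ stAt τ h = s ∧ gtilde M β k h τ = g}

/-- The `k`-step reinforced RCSL policy
`π̃^{k,⋆}_β(a ∣ s, h) = P_β(a_h = a ∣ s_h = s, g̃^k_h = f⋆_k(s, h))`. -/
def relabeledPolicy (M : DetMDP S A H) (β : Pol S A) (k : ℕ) : Pol S A :=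
  fun h s a =>
    (∑ τ : Traj S A H, trajProb M β τ *
        ind (stAt τ h = s ∧ actAt τ h = a ∧ gtilde M β k h τ = fstark M β k s h)) /
      ∑ τ : Traj S A H, trajProb M β τ *
        ind (stAt τ h = s ∧ gtilde M β k h τ = fstark M β k s h)

end

end RCSL

namespace RCSL

section

variable {S A : Type} [Fintype A] {H : ℕ}

lemma ind_of_true {P : Prop} (h : P) : ind P = 1 := by simp [ind, h]

lemma ind_of_false {P : Prop} (h : ¬P) : ind P = 0 := by simp [ind, h]

lemma ind_nonneg (P : Prop) : 0 ≤ ind P := by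
  unfold ind; split_ifs <;> norm_num

lemma IsPolicy.exists_pos {β : Pol S A} (hβ : IsPolicy β) (h : ℕ) (s : S) :
    ∃ a, 0 < β h s a := by
  by_contra! hc
  have h1 : ∑ a, β h s a ≤ 0 := Finset.sum_nonpos fun a _ => hc a
  rw [hβ.2] at h1
  norm_num at h1

lemma IsPolicy.nonempty_support {β : Pol S A} (hβ : IsPolicy β) (h : ℕ) (s : S) :
    Nonempty {a // 0 < β h s a} :=
  let ⟨a, ha⟩ := hβ.exists_pos h s
  ⟨⟨a, ha⟩⟩

lemma sum_ind_actAt [Nonempty A] (τ : Traj S A H) (h : ℕ) (P Q : Prop) :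
    ∑ a, ind (P ∧ actAt τ h = a ∧ Q) = ind (P ∧ Q) := by
  rw [Finset.sum_eq_single (actAt τ h)]
  · simp
  · intro a _ ha
    exact ind_of_false fun hc => ha hc.2.1.symm
  · simp

variable [Fintype S]

/-! ### Bellman recursion for the covered optimal value -/

/-- Optimal value over `β`-supported actions with `n` steps remaining, by backward recursion. -/
noncomputable def optAux (M : DetMDP S A H) (β : Pol S A) : ℕ → ℕ → S → ℝ
  | 0, _, _ => 0
  | n + 1, h, s =>
    ⨆ a : {a // 0 < β h s a}, (M.r h s a + optAux M β n (h + 1) (M.step h s a))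

/-- The backward-recursion optimal value at stage `h`. -/
noncomputable def optVal (M : DetMDP S A H) (β : Pol S A) (h : ℕ) (s : S) : ℝ :=
  optAux M β (H - h) h s

/-- The state–action value associated with `optVal`. -/
noncomputable def optQ (M : DetMDP S A H) (β : Pol S A) (h : ℕ) (s : S) (a : A) : ℝ :=
  M.r h s a + optVal M β (h + 1) (M.step h s a)

lemma optVal_eq_iSup (M : DetMDP S A H) (β : Pol S A) {h : ℕ} (hh : h < H) (s : S) :
    optVal M β h s = ⨆ a : {a // 0 < β h s a}, optQ M β h s a := by
  have e : H - h = (H - (h + 1)) + 1 := by omega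
  unfold optVal optQ
  rw [e]
  rfl

lemma optVal_of_le (M : DetMDP S A H) (β : Pol S A) {h : ℕ} (hh : H ≤ h) (s : S) :
    optVal M β h s = 0 := by
  unfold optVal
  rw [Nat.sub_eq_zero_of_le hh]
  rfl

lemma optQ_le_optVal (M : DetMDP S A H) {β : Pol S A} {h : ℕ} (hh : h < H) {s : S} {a : A}
    (ha : 0 < β h s a) : optQ M β h s a ≤ optVal M β h s := by
  rw [optVal_eq_iSup M β hh]
  exact le_ciSup (f := fun a : {a // 0 < β h s a} => optQ M β h s a)
    (Set.finite_range _).bddAbove ⟨a, ha⟩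

lemma exists_optQ_eq_optVal (M : DetMDP S A H) {β : Pol S A} (hβ : IsPolicy β) {h : ℕ}
    (hh : h < H) (s : S) : ∃ a, 0 < β h s a ∧ optQ M β h s a = optVal M β h s := by
  have := hβ.nonempty_support h s
  obtain ⟨⟨a, ha⟩, h2⟩ :=
    exists_eq_ciSup_of_finite (f := fun a : {a // 0 < β h s a} => optQ M β h s a)
  exact ⟨a, ha, by rw [optVal_eq_iSup M β hh]; exact h2⟩

lemma V_of_lt (M : DetMDP S A H) (π : Pol S A) {h : ℕ} (hh : h < H) (s : S) :
    V M π h s = ∑ a, π h s a * (M.r h s a + V M π (h + 1) (M.step h s a)) := by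
  have e : H - h = (H - (h + 1)) + 1 := by omega
  unfold V
  rw [e]
  rfl

lemma V_of_le (M : DetMDP S A H) (π : Pol S A) {h : ℕ} (hh : H ≤ h) (s : S) :
    V M π h s = 0 := by
  unfold V
  rw [Nat.sub_eq_zero_of_le hh]
  rfl

lemma V_le_optVal (M : DetMDP S A H) {β π : Pol S A} (hπ : PolCovered β π) (h : ℕ) (s : S) :
    V M π h s ≤ optVal M β h s := by
  induction hn : H - h generalizing h s with
  | zero => rw [V_of_le M π (by omega), optVal_of_le M β (by omega)]
  | succ n ih =>
    have hh : h < H := by omega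
    rw [V_of_lt M π hh]
    calc ∑ a, π h s a * (M.r h s a + V M π (h + 1) (M.step h s a))
        ≤ ∑ a, π h s a * optVal M β h s := by
          refine Finset.sum_le_sum fun a _ => ?_
          rcases (hπ.1.1 h s a).eq_or_lt with h0 | h0
          · simp [← h0]
          · refine mul_le_mul_of_nonneg_left (le_trans ?_ (optQ_le_optVal M hh (hπ.2 h s a h0)))
              h0.le
            exact add_le_add_right (ih (h + 1) _ (by omega)) _
      _ = optVal M β h s := by rw [← Finset.sum_mul, hπ.1.2, one_mul]

lemma exists_V_eq_optVal (M : DetMDP S A H) {β : Pol S A} (hβ : IsPolicy β) :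
    ∃ π, PolCovered β π ∧ ∀ h s, V M π h s = optVal M β h s := by
  classical
  have hd : ∀ h s, ∃ a, 0 < β h s a ∧ (h < H → optQ M β h s a = optVal M β h s) := by
    intro h s
    by_cases hh : h < H
    · obtain ⟨a, h1, h2⟩ := exists_optQ_eq_optVal M hβ hh s
      exact ⟨a, h1, fun _ => h2⟩
    · obtain ⟨a, h1⟩ := hβ.exists_pos h s
      exact ⟨a, h1, fun h' => absurd h' hh⟩
  choose d hd1 hd2 using hd
  refine ⟨fun h s a => if a = d h s then 1 else 0, ⟨⟨?_, ?_⟩, ?_⟩, ?_⟩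
  · intro h s a
    dsimp only
    split_ifs <;> norm_num
  · intro h s
    simp
  · intro h s a ha
    by_cases e : a = d h s
    · exact e ▸ hd1 h s
    · simp [e] at ha
  · intro h s
    induction hn : H - h generalizing h s with
    | zero => rw [V_of_le M _ (by omega), optVal_of_le M β (by omega)]
    | succ n ih =>
      have hh : h < H := by omega
      rw [V_of_lt M _ hh, ← hd2 h s hh]
      simp only [ite_mul, one_mul, zero_mul, Finset.sum_ite_eq',
        Finset.mem_univ, if_true]
      rw [ih (h + 1) _ (by omega)]
      rfl

lemma Vstar_eq_optVal (M : DetMDP S A H) {β : Pol S A} (hβ : IsPolicy β) (h : ℕ) (s : S) :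
    Vstar M β h s = optVal M β h s := by
  obtain ⟨π, hπ, hV⟩ := exists_V_eq_optVal M hβ
  refine IsGreatest.csSup_eq ⟨⟨π, hπ, hV h s⟩, ?_⟩
  rintro v ⟨π', hπ', rfl⟩
  exact V_le_optVal M hπ' h s

/-! ### Occupancies, runs and reachable states -/

/-- The state at stage `h` when following the deterministic policy `d` from `s`. -/
def run (M : DetMDP S A H) (d : ℕ → S → A) (s : S) : ℕ → S
  | 0 => s
  | h + 1 => M.step h (run M d s h) (d h (run M d s h))

lemma run_congr (M : DetMDP S A H) {d d' : ℕ → S → A} (s : S) {h : ℕ}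
    (hd : ∀ t < h, d t = d' t) : run M d s h = run M d' s h := by
  induction h with
  | zero => rfl
  | succ h ih =>
    simp only [run]
    rw [ih fun t ht => hd t (by omega), hd h (by omega)]

lemma sum_occ_succ_mul (M : DetMDP S A H) (π : Pol S A) (h : ℕ) (f : S → ℝ) :
    ∑ s', occ M π (h + 1) s' * f s' =
      ∑ s, ∑ a, occ M π h s * π h s a * f (M.step h s a) := by
  simp only [occ, Finset.sum_mul]
  rw [Finset.sum_comm]
  refine Finset.sum_congr rfl fun s _ => ?_
  rw [Finset.sum_comm]
  refine Finset.sum_congr rfl fun a _ => ?_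
  rw [Finset.sum_eq_single (M.step h s a)]
  · rw [ind_of_true rfl, mul_one]
  · intro s' _ hs'
    rw [ind_of_false (Ne.symm hs'), mul_zero, zero_mul]
  · simp

/-- `s` is reached at stage `h` by a deterministic policy supported in `β`. -/
def Reach (M : DetMDP S A H) (β : Pol S A) (h : ℕ) (s : S) : Prop :=
  ∃ s₀ d, 0 < M.ρ s₀ ∧ (∀ t x, 0 < β t x (d t x)) ∧ run M d s₀ h = s

lemma Reach.exists_policy {M : DetMDP S A H} {β : Pol S A} {h : ℕ} {s : S}
    (hr : Reach M β h s) {a : A} (ha : 0 < β h s a) :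
    ∃ s₀ d, 0 < M.ρ s₀ ∧ (∀ t x, 0 < β t x (d t x)) ∧ run M d s₀ h = s ∧ d h s = a := by
  classical
  obtain ⟨s₀, d, h1, h2, h3⟩ := hr
  refine ⟨s₀, Function.update d h (Function.update (d h) s a), h1, fun t x => ?_, ?_, by simp⟩
  · by_cases ht : t = h
    · subst ht
      by_cases hx : x = s
      · subst hx; simpa using ha
      · simpa [hx] using h2 t x
    · simpa [ht] using h2 t x
  · rw [← h3]
    refine run_congr M s₀ fun t ht => ?_
    rw [Function.update_of_ne ht.ne]

lemma Reach.succ {M : DetMDP S A H} {β : Pol S A} {h : ℕ} {s : S}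
    (hr : Reach M β h s) {a : A} (ha : 0 < β h s a) : Reach M β (h + 1) (M.step h s a) := by
  obtain ⟨s₀, d, h1, h2, h3, h4⟩ := hr.exists_policy ha
  exact ⟨s₀, d, h1, h2, by simp only [run]; rw [h3, h4]⟩

lemma reach_zero {M : DetMDP S A H} {β : Pol S A} (hβ : IsPolicy β) {s : S}
    (hs : 0 < M.ρ s) : Reach M β 0 s := by
  choose d hd using fun h s => hβ.exists_pos h s
  exact ⟨s, d, hs, hd, rfl⟩

variable [Nonempty S] [Nonempty A]

/-! ### Feasible trajectories -/

lemma trajProb_nonneg (M : DetMDP S A H) {β : Pol S A} (hβ : IsPolicy β) (τ : Traj S A H) :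
    0 ≤ trajProb M β τ := by
  unfold trajProb
  refine mul_nonneg (mul_nonneg ?_ (Finset.prod_nonneg fun _ _ => hβ.1 _ _ _))
    (Finset.prod_nonneg fun _ _ => ?_)
  · split_ifs
    · exact M.ρ_nonneg _
    · exact zero_le_one
  · split_ifs
    · exact ind_nonneg _
    · exact zero_le_one

lemma trajProb_pos_iff (M : DetMDP S A H) {β : Pol S A} (hβ : IsPolicy β) (τ : Traj S A H) :
    0 < trajProb M β τ ↔ (0 < H → 0 < M.ρ (stAt τ 0)) ∧
      (∀ h < H, 0 < β h (stAt τ h) (actAt τ h)) ∧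
      ∀ h, h + 1 < H → stAt τ (h + 1) = M.step h (stAt τ h) (actAt τ h) := by
  constructor
  · intro hp
    have hne := hp.ne'
    unfold trajProb at hne
    obtain ⟨h12, h3⟩ := mul_ne_zero_iff.1 hne
    obtain ⟨h1, h2⟩ := mul_ne_zero_iff.1 h12
    rw [Finset.prod_ne_zero_iff] at h2 h3
    refine ⟨fun h0 => ?_, fun h hh => ?_, fun h hh => ?_⟩
    · rw [if_pos h0] at h1
      exact lt_of_le_of_ne (M.ρ_nonneg _) h1.symm
    · exact lt_of_le_of_ne (hβ.1 _ _ _) (h2 ⟨h, hh⟩ (Finset.mem_univ _)).symm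
    · have := h3 ⟨h, by omega⟩ (Finset.mem_univ _)
      rw [if_pos hh] at this
      by_contra hc
      exact this (ind_of_false hc)
  · rintro ⟨h1, h2, h3⟩
    unfold trajProb
    refine mul_pos (mul_pos ?_ (Finset.prod_pos fun h _ => h2 h h.2))
      (Finset.prod_pos fun h _ => ?_)
    · split_ifs with h0
      · exact h1 h0
      · exact one_pos
    · split_ifs with hh
      · rw [ind_of_true (h3 h hh)]
        exact one_pos
      · exact one_pos

lemma Reach.exists_traj {M : DetMDP S A H} {β : Pol S A} (hβ : IsPolicy β) {h : ℕ}
    (hh : h < H) {s : S} (hr : Reach M β h s) {a : A} (ha : 0 < β h s a) :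
    ∃ τ : Traj S A H, 0 < trajProb M β τ ∧ stAt τ h = s ∧ actAt τ h = a := by
  obtain ⟨s₀, d, h1, h2, h3, h4⟩ := hr.exists_policy ha
  let τ : Traj S A H := fun t => (run M d s₀ t, d t (run M d s₀ t))
  have hst : ∀ t, t < H → stAt τ t = run M d s₀ t := fun t ht => by simp [stAt, ht, τ]
  have hac : ∀ t, t < H → actAt τ t = d t (run M d s₀ t) := fun t ht => by simp [actAt, ht, τ]
  refine ⟨τ, (trajProb_pos_iff M hβ τ).2 ⟨fun h0 => ?_, fun t ht => ?_, fun t ht => ?_⟩, ?_, ?_⟩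
  · rw [hst 0 h0]; exact h1
  · rw [hst t ht, hac t ht]; exact h2 _ _
  · rw [hst _ ht, hst t (by omega), hac t (by omega)]; rfl
  · rw [hst h hh, h3]
  · rw [hac h hh, h3, h4]

lemma reach_stAt {M : DetMDP S A H} {β : Pol S A} (hβ : IsPolicy β) {τ : Traj S A H}
    (hτ : 0 < trajProb M β τ) {h : ℕ} (hh : h < H) : Reach M β h (stAt τ h) := by
  obtain ⟨h1, h2, h3⟩ := (trajProb_pos_iff M hβ τ).1 hτ
  induction h with
  | zero => exact reach_zero hβ (h1 hh)
  | succ h ih =>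
    rw [h3 h hh]
    exact (ih (by omega)).succ (h2 h (by omega))

/-! ### Relabeled returns -/

lemma fstark_eq_optVal (M : DetMDP S A H) {β : Pol S A} (hβ : IsPolicy β) {k h : ℕ}
    (hh : h < H)
    (hg : ∀ τ, 0 < trajProb M β τ → gtilde M β k h τ = optQ M β h (stAt τ h) (actAt τ h))
    {s : S} (hr : Reach M β h s) : fstark M β k s h = optVal M β h s := by
  obtain ⟨a, ha, hQ⟩ := exists_optQ_eq_optVal M hβ hh s
  obtain ⟨τ, hτ, rfl, rfl⟩ := hr.exists_traj hβ hh ha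
  refine IsGreatest.csSup_eq ⟨⟨τ, hτ, rfl, by rw [hg τ hτ, hQ]⟩, ?_⟩
  rintro g ⟨τ', hτ', hs, rfl⟩
  rw [hg τ' hτ', ← hs]
  exact optQ_le_optVal M hh (((trajProb_pos_iff M hβ τ').1 hτ').2.1 h hh)

lemma gtilde_succ_of_lt (M : DetMDP S A H) (β : Pol S A) (k : ℕ) {h : ℕ} (hh : h + 1 < H)
    (τ : Traj S A H) :
    gtilde M β (k + 1) h τ =
      max (M.r h (stAt τ h) (actAt τ h) + fstark M β k (stAt τ (h + 1)) (h + 1))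
        (M.r h (stAt τ h) (actAt τ h) + gtilde M β (k + 1) (h + 1) τ) := by
  rw [gtilde, if_pos hh]
  rfl

lemma gtilde_last (M : DetMDP S A H) (β : Pol S A) (k : ℕ) {h : ℕ} (hh : h + 1 = H)
    (τ : Traj S A H) : gtilde M β k h τ = M.r h (stAt τ h) (actAt τ h) := by
  induction k with
  | zero =>
    rw [gtilde, rtg, Finset.sum_eq_single (⟨h, by omega⟩ : Fin H)]
    · simp
    · intro t _ ht
      have : ¬ h ≤ (t : ℕ) := fun hc => ht (Fin.ext (by have := t.2; simp; omega))
      rw [if_neg this]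
    · simp
  | succ k ih => rw [gtilde, if_neg (by omega), ih]

lemma gtilde_eq_optQ (M : DetMDP S A H) {β : Pol S A} (hβ : IsPolicy β) {k h : ℕ}
    (hh : h < H) (hk : H - 1 - h ≤ k) {τ : Traj S A H} (hτ : 0 < trajProb M β τ) :
    gtilde M β k h τ = optQ M β h (stAt τ h) (actAt τ h) := by
  induction hn : H - 1 - h generalizing k h τ with
  | zero =>
    rw [gtilde_last M β k (by omega), optQ, optVal_of_le M β (by omega), add_zero]
  | succ n ih =>
    obtain ⟨k, rfl⟩ : ∃ j, k = j + 1 := ⟨k - 1, by omega⟩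
    have hh' : h + 1 < H := by omega
    obtain ⟨-, h2, h3⟩ := (trajProb_pos_iff M hβ τ).1 hτ
    rw [gtilde_succ_of_lt M β k hh',
      fstark_eq_optVal M hβ hh' (fun τ' hτ' => ih hh' (by omega) hτ' (by omega))
        (reach_stAt hβ hτ hh'),
      ih hh' (by omega) hτ (by omega),
      max_eq_left (add_le_add_right (optQ_le_optVal M hh' (h2 _ hh')) _), optQ, ← h3 h hh']

/-! ### The relabeled policy -/

lemma relabeledPolicy_sum (M : DetMDP S A H) {β : Pol S A} (hβ : IsPolicy β) {h : ℕ}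
    (hh : h < H) {s : S} (hr : Reach M β h s) :
    ∑ a, relabeledPolicy M β (H - 1) h s a = 1 := by
  unfold relabeledPolicy
  rw [← Finset.sum_div, Finset.sum_comm]
  simp only [← Finset.mul_sum, sum_ind_actAt]
  refine div_self (ne_of_gt ?_)
  obtain ⟨a, ha, hQ⟩ := exists_optQ_eq_optVal M hβ hh s
  obtain ⟨τ, hτ, hs, hτa⟩ := hr.exists_traj hβ hh ha
  refine Finset.sum_pos'
    (fun τ' _ => mul_nonneg (trajProb_nonneg M hβ τ') (ind_nonneg _)) ⟨τ, Finset.mem_univ _, ?_⟩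
  rw [ind_of_true, mul_one]
  · exact hτ
  · refine ⟨hs, ?_⟩
    rw [gtilde_eq_optQ M hβ hh (by omega) hτ, fstark_eq_optVal M hβ hh
      (fun τ' hτ' => gtilde_eq_optQ M hβ hh (by omega) hτ') hr, hs, hτa, hQ]

lemma of_relabeledPolicy_ne_zero (M : DetMDP S A H) {β : Pol S A} (hβ : IsPolicy β) {h : ℕ}
    (hh : h < H) {s : S} (hr : Reach M β h s) {a : A}
    (ha : relabeledPolicy M β (H - 1) h s a ≠ 0) :
    0 < β h s a ∧ optQ M β h s a = optVal M β h s := by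
  unfold relabeledPolicy at ha
  obtain ⟨τ, -, hτ⟩ := Finset.exists_ne_zero_of_sum_ne_zero (div_ne_zero_iff.1 ha).1
  obtain ⟨h1, h2⟩ := mul_ne_zero_iff.1 hτ
  have hpos : 0 < trajProb M β τ := lt_of_le_of_ne (trajProb_nonneg M hβ τ) h1.symm
  obtain ⟨rfl, rfl, hg⟩ := not_not.1 fun hc => h2 (ind_of_false hc)
  refine ⟨((trajProb_pos_iff M hβ τ).1 hpos).2.1 h hh, ?_⟩
  rw [← gtilde_eq_optQ M hβ hh (k := H - 1) (by omega) hpos, hg, fstark_eq_optVal M hβ hh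
    (fun τ' hτ' => gtilde_eq_optQ M hβ hh (by omega) hτ') hr]

lemma reach_of_occ_ne_zero (M : DetMDP S A H) {β : Pol S A} (hβ : IsPolicy β) {h : ℕ}
    (hh : h ≤ H) {s : S} (hs : occ M (relabeledPolicy M β (H - 1)) h s ≠ 0) :
    Reach M β h s := by
  induction h generalizing s with
  | zero => exact reach_zero hβ (lt_of_le_of_ne (M.ρ_nonneg s) (Ne.symm hs))
  | succ h ih =>
    rw [occ] at hs
    obtain ⟨x, -, hx⟩ := Finset.exists_ne_zero_of_sum_ne_zero hs
    obtain ⟨a, -, ha⟩ := Finset.exists_ne_zero_of_sum_ne_zero hx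
    obtain ⟨h12, h3⟩ := mul_ne_zero_iff.1 ha
    obtain ⟨h1, h2⟩ := mul_ne_zero_iff.1 h12
    obtain rfl := not_not.1 fun hc => h3 (ind_of_false hc)
    have hr := ih (by omega) h1
    exact hr.succ (of_relabeledPolicy_ne_zero M hβ (by omega) hr h2).1

lemma sum_occ_mul_optVal (M : DetMDP S A H) {β : Pol S A} (hβ : IsPolicy β) {h : ℕ}
    (hh : h < H) :
    ∑ s, occ M (relabeledPolicy M β (H - 1)) h s * optVal M β h s =
      ∑ s, ∑ a, occ M (relabeledPolicy M β (H - 1)) h s *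
          relabeledPolicy M β (H - 1) h s a * M.r h s a +
        ∑ s, occ M (relabeledPolicy M β (H - 1)) (h + 1) s * optVal M β (h + 1) s := by
  rw [sum_occ_succ_mul, ← Finset.sum_add_distrib]
  refine Finset.sum_congr rfl fun s _ => ?_
  rw [← Finset.sum_add_distrib]
  by_cases hs : occ M (relabeledPolicy M β (H - 1)) h s = 0
  · simp [hs]
  have hr := reach_of_occ_ne_zero M hβ hh.le hs
  calc occ M (relabeledPolicy M β (H - 1)) h s * optVal M β h s
      = ∑ a, occ M (relabeledPolicy M β (H - 1)) h s *
          relabeledPolicy M β (H - 1) h s a * optVal M β h s := by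
        rw [← Finset.sum_mul, ← Finset.mul_sum, relabeledPolicy_sum M hβ hh hr, mul_one]
    _ = _ := by
        refine Finset.sum_congr rfl fun a _ => ?_
        by_cases ha : relabeledPolicy M β (H - 1) h s a = 0
        · simp [ha]
        · rw [← (of_relabeledPolicy_ne_zero M hβ hh hr ha).2, optQ, mul_add]

end

/-- In a finite deterministic episodic MDP with behavior policy `β`, the
`(H−1)`-step reinforced RCSL policy satisfies `J(π̃^{H−1,⋆}_β) = E_{s∼ρ}[V_1^{⋆,β}(s)]`:
multi-step return relabeling with `H − 1` passes recovers the optimal value achievable by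
any policy whose action supports are contained in those of `β`. -/
theorem stmt4 {S A : Type} [Fintype S] [Fintype A] [Nonempty S] [Nonempty A] {H : ℕ}
    (M : DetMDP S A H) (β : Pol S A) (hβ : IsPolicy β) :
    J M (relabeledPolicy M β (H - 1)) = ∑ s, M.ρ s * Vstar M β 0 s := by
  have key : ∀ n ≤ H, ∑ h ∈ Finset.range n, ∑ s, ∑ a,
      occ M (relabeledPolicy M β (H - 1)) h s * relabeledPolicy M β (H - 1) h s a * M.r h s a +
        ∑ s, occ M (relabeledPolicy M β (H - 1)) n s * optVal M β n s =
      ∑ s, M.ρ s * optVal M β 0 s := by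
    intro n
    induction n with
    | zero => simp [occ]
    | succ n ih =>
      intro hn
      rw [Finset.sum_range_succ, add_assoc, ← sum_occ_mul_optVal M hβ hn, ih (by omega)]
  have hH := key H le_rfl
  simp only [optVal_of_le M β le_rfl, mul_zero, Finset.sum_const_zero, add_zero] at hH
  simpa only [J, Vstar_eq_optVal M hβ] using hH

end RCSL
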